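/- arXiv:1605.09360 — 2 statements merged into one kernel-verified Lean document; each statement's English description precedes it below -/
import Mathlib

section
/- Let F be a number field. There exists a square-free ideal q of the ring of integers O_F such that every unit u in O_F^× that is a square modulo q (i.e., u ≡ v² mod q for some v in O_F) is actually a square in O_F^×. -/
open NumberField
open IsDedekindDomain Filter Topology
open scoped ENNReal

noncomputable def msum {ι : Type*} (w : ι → ℝ≥0∞) : ℝ≥0∞ :=
  ∑' m : Multiset ι, (m.map w).prod

noncomputable def pw (K : Type*) [Field K] [NumberField K] (s : ℝ)
    (p : HeightOneSpectrum (𝓞 K)) : ℝ≥0∞ := (Ideal.absNorm p.asIdeal : ℝ≥0∞) ^ (-s)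

lemma msum_step {ι : Type*} (w : ι → ℝ≥0∞) (p : ι) (hw : w p ≤ 2⁻¹) (S : Set ι) :
    (∑' m : {m : Multiset ι // ∀ q ∈ m, q ∉ S}, (m.1.map w).prod) ≤
    2 * ∑' m : {m : Multiset ι // ∀ q ∈ m, q ∉ insert p S}, (m.1.map w).prod := by
  classical
  by_cases hp : p ∈ S
  · rw [Set.insert_eq_of_mem hp]
    exact le_mul_of_one_le_left' (by norm_num)
  let f : ℕ × {m : Multiset ι // ∀ q ∈ m, q ∉ insert p S} → {m : Multiset ι // ∀ q ∈ m, q ∉ S} :=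
    fun x => ⟨Multiset.replicate x.1 p + x.2.1, by
      intro q hq
      rcases Multiset.mem_add.1 hq with h | h
      · rw [Multiset.eq_of_mem_replicate h]; exact hp
      · have := x.2.2 q h
        simp only [Set.mem_insert_iff, not_or] at this
        exact this.2⟩
  have hf : Function.Surjective f := by
    rintro ⟨m, hm⟩
    refine ⟨(m.count p, ⟨m.filter (fun q => ¬ q = p), ?_⟩), ?_⟩
    · intro q hq
      rw [Multiset.mem_filter] at hq
      simp only [Set.mem_insert_iff, not_or]
      exact ⟨hq.2, hm q hq.1⟩
    · apply Subtype.ext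
      change Multiset.replicate _ _ + Multiset.filter _ _ = m
      rw [← Multiset.filter_eq']
      exact Multiset.filter_add_not _ _
  refine (ENNReal.tsum_le_tsum_comp_of_surjective hf _).trans ?_
  rw [ENNReal.tsum_prod']
  have : ∀ k : ℕ, (∑' m : {m : Multiset ι // ∀ q ∈ m, q ∉ insert p S}, ((f (k, m)).1.map w).prod)
      ≤ 2⁻¹ ^ k * ∑' m : {m : Multiset ι // ∀ q ∈ m, q ∉ insert p S}, (m.1.map w).prod := by
    intro k
    rw [← ENNReal.tsum_mul_left]
    refine ENNReal.tsum_le_tsum fun m => ?_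
    simp only [f, Multiset.map_add, Multiset.prod_add, Multiset.map_replicate,
      Multiset.prod_replicate]
    gcongr
  refine (ENNReal.tsum_le_tsum this).trans ?_
  rw [ENNReal.tsum_mul_right, ENNReal.tsum_geometric, ENNReal.one_sub_inv_two, inv_inv]

lemma msum_bad {ι : Type*} (w : ι → ℝ≥0∞) (hw : ∀ p, w p ≤ 2⁻¹) (S : Set ι) (hS : S.Finite) :
    msum w ≤ 2 ^ S.ncard * msum (fun p : {p // p ∉ S} => w p) := by
  have h1 : msum w ≤ 2 ^ S.ncard *
      ∑' m : {m : Multiset ι // ∀ q ∈ m, q ∉ S}, (m.1.map w).prod := by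
    induction S, hS using Set.Finite.induction_on with
    | empty =>
      simp only [Set.ncard_empty, pow_zero, one_mul]
      let f : {m : Multiset ι // ∀ q ∈ m, q ∉ (∅ : Set ι)} → Multiset ι := fun m => m.1
      have hf : Function.Surjective f := fun m => ⟨⟨m, by simp⟩, rfl⟩
      exact ENNReal.tsum_le_tsum_comp_of_surjective hf _
    | @insert p S hp hS ih =>
      refine ih.trans ?_
      rw [Set.ncard_insert_of_notMem hp hS, pow_succ, mul_assoc]
      gcongr
      exact msum_step w p (hw p) S
  refine h1.trans ?_
  gcongr
  let f : Multiset {p // p ∉ S} → {m : Multiset ι // ∀ q ∈ m, q ∉ S} := fun m =>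
    ⟨m.map Subtype.val, by
      intro q hq
      obtain ⟨a, -, rfl⟩ := Multiset.mem_map.1 hq
      exact a.2⟩
  have hf : Function.Surjective f := by
    rintro ⟨m, hm⟩
    refine ⟨m.attach.map (fun q => ⟨q.1, hm q.1 q.2⟩), ?_⟩
    apply Subtype.ext
    simp [f]
  refine (ENNReal.tsum_le_tsum_comp_of_surjective hf _).trans (le_of_eq ?_)
  unfold msum
  congr 1
  ext m
  simp [f]

lemma msum_sq {ι κ : Type*} (w : ι → ℝ≥0∞) (v : κ → ℝ≥0∞) (f : ι ⊕ ι → κ)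
    (hf : Function.Injective f) (hw : ∀ i, w i ≤ v (f (.inl i))) (hw' : ∀ i, w i ≤ v (f (.inr i))) :
    msum w ^ 2 ≤ msum v := by
  let g : Multiset ι × Multiset ι → Multiset κ := fun x =>
    (x.1.map Sum.inl + x.2.map Sum.inr).map f
  have hg : Function.Injective g := by
    classical
    refine (Multiset.map_injective hf).comp ?_
    rintro ⟨a, b⟩ ⟨c, d⟩ h
    simp only at h
    refine Prod.ext ?_ ?_
    · ext i
      have := congrArg (Multiset.count (Sum.inl i)) h
      simpa [Multiset.count_map_eq_count' _ _ Sum.inl_injective, Multiset.count_eq_zero] using this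
    · ext i
      have := congrArg (Multiset.count (Sum.inr i)) h
      simpa [Multiset.count_map_eq_count' _ _ Sum.inr_injective, Multiset.count_eq_zero] using this
  refine le_trans ?_ (ENNReal.tsum_comp_le_tsum_of_injective hg _)
  rw [ENNReal.tsum_prod', sq, msum, ← ENNReal.tsum_mul_right]
  refine ENNReal.tsum_le_tsum fun a => ?_
  rw [← ENNReal.tsum_mul_left]
  refine ENNReal.tsum_le_tsum fun b => ?_
  simp only [g, Multiset.map_add, Multiset.prod_add, Multiset.map_map]
  refine mul_le_mul' ?_ ?_
  · exact Multiset.prod_map_le_prod_map _ _ fun i _ => hw i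
  · exact Multiset.prod_map_le_prod_map _ _ fun i _ => hw' i

section zeta
variable (K : Type*) [Field K] [NumberField K]

lemma msum_pw_eq (s : ℝ) : msum (pw K s) =
    ∑' n : ℕ, (Nat.card {I : Ideal (𝓞 K) // Ideal.absNorm I = n} : ℝ≥0∞) *
      (if n = 0 then 0 else (n : ℝ≥0∞) ^ (-s)) := by
  classical
  let G : ℕ → ℝ≥0∞ := fun n => if n = 0 then 0 else (n : ℝ≥0∞) ^ (-s)
  let e : Multiset (HeightOneSpectrum (𝓞 K)) → Ideal (𝓞 K) := fun m =>
    (m.map HeightOneSpectrum.asIdeal).prod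
  have hprime : ∀ m : Multiset (HeightOneSpectrum (𝓞 K)),
      ∀ p ∈ m.map HeightOneSpectrum.asIdeal, Prime p := by
    intro m p hp
    obtain ⟨q, -, rfl⟩ := Multiset.mem_map.1 hp
    exact q.prime
  have he : Function.Injective e := by
    intro a b h
    have h2 := congrArg UniqueFactorizationMonoid.normalizedFactors h
    simp only [e] at h2
    rw [UniqueFactorizationMonoid.normalizedFactors_prod_of_prime (hprime a),
      UniqueFactorizationMonoid.normalizedFactors_prod_of_prime (hprime b)] at h2
    exact Multiset.map_injective (fun p q h => HeightOneSpectrum.ext h) h2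
  have h1 : msum (pw K s) = ∑' m, G (Ideal.absNorm (e m)) := by
    unfold msum
    congr 1
    ext m
    have hne : Ideal.absNorm (e m) ≠ 0 := by
      rw [Ne, Ideal.absNorm_eq_zero_iff]
      exact Multiset.prod_ne_zero fun h => (hprime m _ h).ne_zero rfl
    simp only [G, if_neg hne]
    clear hne
    induction m using Multiset.induction with
    | empty => simp [e]
    | cons p m ih =>
      have : e (p ::ₘ m) = p.asIdeal * e m := by simp [e]
      rw [this, Multiset.map_cons, Multiset.prod_cons, ih, map_mul, Nat.cast_mul,
        ENNReal.mul_rpow_of_ne_top (by simp) (by simp)]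
      rfl
  have h2 : ∑' m, G (Ideal.absNorm (e m)) = ∑' I : Ideal (𝓞 K), G (Ideal.absNorm I) := by
    refine he.tsum_eq (f := fun I => G (Ideal.absNorm I)) ?_
    intro I hI
    have hI0 : I ≠ 0 := by
      rintro rfl
      simp [G] at hI
    have hp : ∀ q ∈ UniqueFactorizationMonoid.normalizedFactors I, Prime q :=
      fun q hq => UniqueFactorizationMonoid.prime_of_normalized_factor q hq
    refine ⟨(UniqueFactorizationMonoid.normalizedFactors I).attach.map
      (fun q => ⟨q.1, Ideal.isPrime_of_prime (hp q.1 q.2), (hp q.1 q.2).ne_zero⟩), ?_⟩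
    simp only [e, Multiset.map_map, Function.comp_def]
    rw [Multiset.attach_map_val]
    exact Ideal.prod_normalizedFactors_eq_self hI0
  rw [h1, h2, ← (Equiv.sigmaFiberEquiv (Ideal.absNorm : Ideal (𝓞 K) → ℕ)).tsum_eq,
    ENNReal.tsum_sigma']
  congr 1
  ext n
  have : ∀ x : {I : Ideal (𝓞 K) // Ideal.absNorm I = n},
     G (Ideal.absNorm ((Equiv.sigmaFiberEquiv (Ideal.absNorm : Ideal (𝓞 K) → ℕ)) ⟨n, x⟩)) = G n := by
    rintro ⟨x, rfl⟩
    rfl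
  simp_rw [this]
  by_cases hn : n = 0
  · simp [G, hn]
  · have : Finite {I : Ideal (𝓞 K) // Ideal.absNorm I = n} :=
      (Ideal.finite_setOfPred_absNorm_eq n)
    rw [ENNReal.tsum_const, ENat.card_eq_coe_natCard]
    simp [G]

lemma tendsto_msum_pw : Tendsto (fun s : ℝ => ENNReal.ofReal (s - 1) * msum (pw K s)) (𝓝[>] 1)
    (𝓝 (ENNReal.ofReal (dedekindZeta_residue K))) := by
  have h := tendsto_sub_one_mul_dedekindZeta_nhdsGT K
  have hne : ∀ᶠ s : ℝ in 𝓝[>] 1, ((s : ℂ) - 1) * dedekindZeta K s ≠ 0 :=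
    h.eventually_ne (by exact_mod_cast dedekindZeta_residue_ne_zero K)
  have hre := (Complex.continuous_re.tendsto _).comp h
  refine ((ENNReal.continuous_ofReal.tendsto _).comp hre).congr' ?_
  filter_upwards [hne, self_mem_nhdsWithin] with s hs (hs1 : 1 < s)
  let a : ℕ → ℝ := fun n => (Nat.card {I : Ideal (𝓞 K) // Ideal.absNorm I = n} : ℝ) *
      (if n = 0 then 0 else (n : ℝ) ^ (-s))
  have ha0 : ∀ n, 0 ≤ a n := fun n => by
    simp only [a]; split_ifs <;> positivity
  have hterm : ∀ n, LSeries.term (fun n ↦ (Nat.card {I : Ideal (𝓞 K) // Ideal.absNorm I = n} : ℂ)) s n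
      = (a n : ℂ) := by
    intro n
    rw [LSeries.term_def]
    simp only [a]
    split_ifs with h
    · simp
    · rw [Real.rpow_neg (by positivity)]
      push_cast
      rw [Complex.ofReal_cpow (by positivity)]
      simp [div_eq_mul_inv]
  have hz : dedekindZeta K s = ((∑' n, a n : ℝ) : ℂ) := by
    rw [dedekindZeta, LSeries, Complex.ofReal_tsum]
    exact tsum_congr hterm
  have hsum : Summable a := by
    by_contra hcon
    rw [hz, tsum_eq_zero_of_not_summable hcon] at hs
    simp at hs
  have : msum (pw K s) = ENNReal.ofReal (∑' n, a n) := by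
    rw [msum_pw_eq, ENNReal.ofReal_tsum_of_nonneg ha0 hsum]
    refine tsum_congr fun n => ?_
    simp only [a]
    rw [ENNReal.ofReal_mul (by positivity), ENNReal.ofReal_natCast]
    split_ifs with h
    · simp
    · rw [← ENNReal.ofReal_rpow_of_pos (by positivity), ENNReal.ofReal_natCast]
  rw [this, ← ENNReal.ofReal_mul (by linarith)]
  simp only [Function.comp_apply, hz]
  congr 1
  rw [← Complex.ofReal_one, ← Complex.ofReal_sub, ← Complex.ofReal_mul, Complex.ofReal_re]

lemma pw_le_half (s : ℝ) (hs : 1 < s) (p : HeightOneSpectrum (𝓞 K)) : pw K s p ≤ 2⁻¹ := by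
  have h0 : Ideal.absNorm p.asIdeal ≠ 0 := by
    rw [Ne, Ideal.absNorm_eq_zero_iff]; exact p.ne_bot
  have h1 : Ideal.absNorm p.asIdeal ≠ 1 := by
    rw [Ne, Ideal.absNorm_eq_one_iff]; exact p.isPrime.ne_top
  have h2 : 2 ≤ Ideal.absNorm p.asIdeal := by omega
  unfold pw
  rw [ENNReal.rpow_neg, ENNReal.inv_le_inv]
  have h3 : (2 : ℝ≥0∞) ≤ (Ideal.absNorm p.asIdeal : ℝ≥0∞) := by exact_mod_cast h2
  refine h3.trans ?_
  conv_lhs => rw [← ENNReal.rpow_one (Ideal.absNorm p.asIdeal : ℝ≥0∞)]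
  exact ENNReal.rpow_le_rpow_of_exponent_le (le_trans (by norm_num) h3) hs.le

end zeta

lemma no_double (F K : Type*) [Field F] [NumberField F] [Field K] [NumberField K]
    (S : Set (HeightOneSpectrum (𝓞 F))) (hS : S.Finite)
    (f : {p // p ∉ S} ⊕ {p // p ∉ S} → HeightOneSpectrum (𝓞 K)) (hf : Function.Injective f)
    (hl : ∀ p, Ideal.absNorm (f (.inl p)).asIdeal ≤ Ideal.absNorm p.1.asIdeal)
    (hr : ∀ p, Ideal.absNorm (f (.inr p)).asIdeal ≤ Ideal.absNorm p.1.asIdeal) : False := by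
  have hF := tendsto_msum_pw F
  have hK := tendsto_msum_pw K
  have hmono : ∀ s : ℝ, 1 < s → ∀ a b : ℕ, a ≤ b → (b : ℝ≥0∞) ^ (-s) ≤ (a : ℝ≥0∞) ^ (-s) := by
    intro s hs a b hab
    rw [ENNReal.rpow_neg, ENNReal.rpow_neg, ENNReal.inv_le_inv]
    exact ENNReal.rpow_le_rpow (by exact_mod_cast hab) (by linarith)
  set C : ℝ≥0∞ := 2 ^ S.ncard with hC
  have key : ∀ᶠ s : ℝ in 𝓝[>] 1, (ENNReal.ofReal (s - 1) * msum (pw F s)) ^ 2 ≤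
      (C ^ 2 * ENNReal.ofReal (s - 1)) * (ENNReal.ofReal (s - 1) * msum (pw K s)) := by
    filter_upwards [self_mem_nhdsWithin] with s (hs : 1 < s)
    have h1 := msum_bad (pw F s) (pw_le_half F s hs) S hS
    have h2 := msum_sq (fun p : {p // p ∉ S} => pw F s p) (pw K s) f hf
      (fun p => hmono s hs _ _ (hl p)) (fun p => hmono s hs _ _ (hr p))
    calc (ENNReal.ofReal (s - 1) * msum (pw F s)) ^ 2
        ≤ (ENNReal.ofReal (s - 1) * (C * msum (fun p : {p // p ∉ S} => pw F s p))) ^ 2 := by gcongr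
      _ = (C ^ 2 * ENNReal.ofReal (s - 1)) * (ENNReal.ofReal (s - 1) *
            msum (fun p : {p // p ∉ S} => pw F s p) ^ 2) := by ring
      _ ≤ _ := by gcongr
  have ht : Tendsto (fun s : ℝ => C ^ 2 * ENNReal.ofReal (s - 1)) (𝓝[>] 1) (𝓝 0) := by
    have h0 : Tendsto (fun s : ℝ => ENNReal.ofReal (s - 1)) (𝓝[>] 1) (𝓝 0) := by
      have : Tendsto (fun s : ℝ => s - 1) (𝓝[>] 1) (𝓝 (1 - 1)) :=
        tendsto_nhdsWithin_of_tendsto_nhds ((continuous_id.sub continuous_const).tendsto 1)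
      simpa using ENNReal.tendsto_ofReal this
    have hCt : C ^ 2 ≠ ∞ := by simp [hC]
    simpa using ENNReal.Tendsto.const_mul h0 (Or.inr hCt)
  have hR := ENNReal.Tendsto.mul ht (Or.inr ENNReal.ofReal_ne_top) hK (Or.inr ENNReal.zero_ne_top)
  have hL := ENNReal.Tendsto.pow (n := 2) hF
  have := le_of_tendsto_of_tendsto hL hR key
  simp only [zero_mul, nonpos_iff_eq_zero, pow_eq_zero_iff two_ne_zero,
    ENNReal.ofReal_eq_zero] at this
  exact absurd (dedekindZeta_residue_pos F) (not_lt.2 this)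

lemma absNorm_le_of_liesOver {F K : Type*} [Field F] [NumberField F] [Field K] [NumberField K]
    [Algebra F K] (p : Ideal (𝓞 F)) (Q : Ideal (𝓞 K)) (hQ : Q ≠ ⊥)
    (h : Q.comap (algebraMap (𝓞 F) (𝓞 K)) = p) : Ideal.absNorm p ≤ Ideal.absNorm Q := by
  have : Finite (𝓞 K ⧸ Q) := (Ideal.absNorm_ne_zero_iff Q).1 (by
    rwa [Ne, Ideal.absNorm_eq_zero_iff])
  subst h
  change Nat.card (𝓞 F ⧸ Q.comap (algebraMap (𝓞 F) (𝓞 K))) ≤ Nat.card (𝓞 K ⧸ Q)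
  exact Nat.card_le_card_of_injective _
    (Ideal.quotientMap_injective (I := Q) (f := algebraMap (𝓞 F) (𝓞 K)))

lemma split_prime {F K : Type*} [Field F] [NumberField F] [Field K] [NumberField K]
    [Algebra F K] (hfin : Module.finrank F K = 2) (u : 𝓞 F) (hu : IsUnit u) (θ : 𝓞 K)
    (hθ : θ ^ 2 = algebraMap (𝓞 F) (𝓞 K) u) (σ : K ≃ₐ[F] K) (hσ : σ (θ : K) = -θ)
    (p : HeightOneSpectrum (𝓞 F)) (h2 : (2 : 𝓞 F) ∉ p.asIdeal) (v : 𝓞 F)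
    (hv : u - v ^ 2 ∈ p.asIdeal) :
    ∃ P P' : HeightOneSpectrum (𝓞 K), P ≠ P' ∧
      P.asIdeal.comap (algebraMap (𝓞 F) (𝓞 K)) = p.asIdeal ∧
      P'.asIdeal.comap (algebraMap (𝓞 F) (𝓞 K)) = p.asIdeal ∧
      Ideal.absNorm P.asIdeal ≤ Ideal.absNorm p.asIdeal ∧
      Ideal.absNorm P'.asIdeal ≤ Ideal.absNorm p.asIdeal := by
  have hpm : p.asIdeal.IsMaximal := p.isMaximal
  obtain ⟨Q, hQm, hQo⟩ := Ideal.exists_maximal_ideal_liesOver_of_isIntegral p.asIdeal (S := 𝓞 K)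
  have hQc : Q.comap (algebraMap (𝓞 F) (𝓞 K)) = p.asIdeal := hQo.over.symm
  let τ : 𝓞 K ≃+* 𝓞 K := RingOfIntegers.mapRingEquiv (σ : K ≃+* K)
  have hτa : ∀ x : 𝓞 F, τ (algebraMap (𝓞 F) (𝓞 K) x) = algebraMap (𝓞 F) (𝓞 K) x := by
    intro x
    apply RingOfIntegers.ext
    change σ (algebraMap F K (x : F)) = algebraMap F K x
    simp
  have hτθ : τ θ = -θ := by
    apply RingOfIntegers.ext
    change σ (θ : K) = _
    rw [hσ]; rfl
  let Q' : Ideal (𝓞 K) := Q.comap τ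
  have hQ'm : Q'.IsMaximal := Ideal.comap_isMaximal_of_equiv τ
  have hQ'c : Q'.comap (algebraMap (𝓞 F) (𝓞 K)) = p.asIdeal := by
    rw [← hQc]
    ext x
    simp only [Q', Ideal.mem_comap]
    rw [hτa]
  have hbot : ∀ R : Ideal (𝓞 K), R.comap (algebraMap (𝓞 F) (𝓞 K)) = p.asIdeal → R ≠ ⊥ := by
    rintro R hR rfl
    apply p.ne_bot
    rw [← hR, ← RingHom.ker_eq_comap_bot]
    exact (RingHom.injective_iff_ker_eq_bot _).1 (FaithfulSMul.algebraMap_injective (𝓞 F) (𝓞 K))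
  have hθu : IsUnit θ := by
    have : IsUnit (θ ^ 2) := hθ ▸ hu.map _
    exact (isUnit_pow_iff two_ne_zero).1 this
  have hne : Q ≠ Q' := by
    intro hQQ
    have hmem : (θ - algebraMap (𝓞 F) (𝓞 K) v) * (θ + algebraMap (𝓞 F) (𝓞 K) v) ∈ Q := by
      have : (θ - algebraMap (𝓞 F) (𝓞 K) v) * (θ + algebraMap (𝓞 F) (𝓞 K) v) =
          algebraMap (𝓞 F) (𝓞 K) (u - v ^ 2) := by
        rw [map_sub, map_pow, ← hθ]; ring
      rw [this, ← Ideal.mem_comap, hQc]; exact hv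
    have hboth : θ - algebraMap (𝓞 F) (𝓞 K) v ∈ Q ∧ θ + algebraMap (𝓞 F) (𝓞 K) v ∈ Q := by
      rcases hQm.isPrime.mem_or_mem hmem with h | h
      · refine ⟨h, ?_⟩
        rw [hQQ, Ideal.mem_comap]
        rw [map_add, hτθ, hτa, ← neg_mem_iff]
        convert h using 1; ring
      · refine ⟨?_, h⟩
        rw [hQQ, Ideal.mem_comap]
        rw [map_sub, hτθ, hτa, ← neg_mem_iff]
        convert h using 1; ring
    have h2θ : 2 * θ ∈ Q := by
      convert Q.add_mem hboth.1 hboth.2 using 1; ring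
    rcases hQm.isPrime.mem_or_mem h2θ with h | h
    · apply h2
      rw [← hQc, Ideal.mem_comap, map_ofNat]
      exact h
    · exact hQm.ne_top (Ideal.eq_top_of_isUnit_mem _ h hθu)
  have hcop : IsCoprime Q Q' := Ideal.isCoprime_of_isMaximal hne
  have hle : p.asIdeal.map (algebraMap (𝓞 F) (𝓞 K)) ≤ Q * Q' := by
    rw [Ideal.mul_eq_inf_of_isCoprime hcop, le_inf_iff, Ideal.map_le_iff_le_comap,
      Ideal.map_le_iff_le_comap, hQc, hQ'c]
    exact ⟨le_rfl, le_rfl⟩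
  have hfin' : Module.finrank (𝓞 F) (𝓞 K) = 2 := by
    rw [← hfin]
    exact (IsFractionRing.finrank_eq (𝓞 F) F (𝓞 K) K).symm
  have hdvd := Ideal.absNorm_dvd_absNorm_of_le hle
  rw [Ideal.absNorm_algebraMap, hfin', map_mul] at hdvd
  have hp0 : 0 < Ideal.absNorm p.asIdeal := by
    rw [Nat.pos_iff_ne_zero, Ne, Ideal.absNorm_eq_zero_iff]; exact p.ne_bot
  have hle' := Nat.le_of_dvd (by positivity) hdvd
  have h1 := absNorm_le_of_liesOver p.asIdeal Q (hbot Q hQc) hQc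
  have h1' := absNorm_le_of_liesOver p.asIdeal Q' (hbot Q' hQ'c) hQ'c
  refine ⟨⟨Q, hQm.isPrime, hbot Q hQc⟩, ⟨Q', hQ'm.isPrime, hbot Q' hQ'c⟩, ?_, hQc, hQ'c, ?_, ?_⟩
  · intro h
    exact hne (congrArg HeightOneSpectrum.asIdeal h)
  · change Ideal.absNorm Q ≤ _
    nlinarith
  · change Ideal.absNorm Q' ≤ _
    nlinarith

lemma exists_prime_aux {F K : Type*} [Field F] [NumberField F] [Field K] [NumberField K]
    [Algebra F K] (hfin : Module.finrank F K = 2) (u : 𝓞 F) (hu : IsUnit u) (θ : 𝓞 K)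
    (hθ : θ ^ 2 = algebraMap (𝓞 F) (𝓞 K) u) (σ : K ≃ₐ[F] K) (hσ : σ (θ : K) = -θ) :
    ∃ p : HeightOneSpectrum (𝓞 F), ∀ v : 𝓞 F, u - v ^ 2 ∉ p.asIdeal := by
  by_contra! hcon
  let S : Set (HeightOneSpectrum (𝓞 F)) := {p | (2 : 𝓞 F) ∈ p.asIdeal}
  have hS : S.Finite := by
    have := Ideal.finite_factors (I := Ideal.span {(2 : 𝓞 F)})
      (by simp [Ideal.zero_eq_bot, Ideal.span_singleton_eq_bot])
    refine this.subset fun p hp => ?_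
    change p.asIdeal ∣ _
    rw [Ideal.dvd_span_singleton]
    exact hp
  have hex : ∀ p : {p // p ∉ S}, _ := fun p =>
    split_prime hfin u hu θ hθ σ hσ p.1 p.2 (hcon p.1).choose (hcon p.1).choose_spec
  choose P P' hne hP hP' hn hn' using hex
  refine no_double F K S hS (Sum.elim P P') ?_ hn hn'
  have hinj : ∀ p q : {p // p ∉ S}, p.1.asIdeal = q.1.asIdeal → p = q := fun p q h =>
    Subtype.ext (HeightOneSpectrum.ext h)
  rintro (p | p) (q | q) h
  · simp only [Sum.elim_inl] at h
    rw [hinj p q (by rw [← hP p, ← hP q, h])]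
  · simp only [Sum.elim_inl, Sum.elim_inr] at h
    obtain rfl := hinj p q (by rw [← hP p, ← hP' q, h])
    exact absurd h (hne p)
  · simp only [Sum.elim_inl, Sum.elim_inr] at h
    obtain rfl := hinj p q (by rw [← hP' p, ← hP q, h])
    exact absurd h.symm (hne p)
  · simp only [Sum.elim_inr] at h
    rw [hinj p q (by rw [← hP' p, ← hP' q, h])]

open Polynomial in
lemma exists_prime {F : Type*} [Field F] [NumberField F] (u : (𝓞 F)ˣ)
    (hu : ¬ ∃ w : (𝓞 F)ˣ, u = w ^ 2) :
    ∃ p : HeightOneSpectrum (𝓞 F), ∀ v : 𝓞 F, (u : 𝓞 F) - v ^ 2 ∉ p.asIdeal := by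
  let a : F := ((u : 𝓞 F) : F)
  have ha : ∀ b : F, b ^ 2 ≠ a := by
    intro b hb
    have hbint : IsIntegral ℤ b := by
      refine IsIntegral.of_pow two_pos ?_
      rw [hb]; exact RingOfIntegers.isIntegral_coe _
    let c : 𝓞 F := ⟨b, hbint⟩
    have hc : c ^ 2 = (u : 𝓞 F) := by
      apply RingOfIntegers.ext
      exact hb
    have hcu : IsUnit c := (isUnit_pow_iff two_ne_zero).1 (hc ▸ u.isUnit)
    refine hu ⟨hcu.unit, ?_⟩
    apply Units.ext
    simp [hc]
  have hirr : Irreducible (X ^ 2 - C a : F[X]) :=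
    X_pow_sub_C_irreducible_of_prime Nat.prime_two ha
  have : Fact (Irreducible (X ^ 2 - C a : F[X])) := ⟨hirr⟩
  let f : F[X] := X ^ 2 - C a
  have hf0 : f ≠ 0 := hirr.ne_zero
  have hdeg : f.natDegree = 2 := natDegree_X_pow_sub_C
  let K := AdjoinRoot f
  have : FiniteDimensional F K := (AdjoinRoot.powerBasis hf0).finite
  have : CharZero K := charZero_of_injective_algebraMap (algebraMap F K).injective
  have : FiniteDimensional ℚ K := FiniteDimensional.trans ℚ F K
  have : NumberField K := ⟨⟩
  have hfin : Module.finrank F K = 2 := by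
    rw [(AdjoinRoot.powerBasis hf0).finrank, AdjoinRoot.powerBasis_dim, hdeg]
  let r : K := AdjoinRoot.root f
  have hr : r ^ 2 = algebraMap F K a := by
    have h := AdjoinRoot.eval₂_root f
    simp only [f, eval₂_sub, eval₂_pow, eval₂_X, eval₂_C] at h
    exact sub_eq_zero.1 h
  have hrint : IsIntegral ℤ r := by
    refine IsIntegral.of_pow two_pos ?_
    rw [hr]; exact (RingOfIntegers.isIntegral_coe (u : 𝓞 F)).algebraMap
  let σ₀ : K →ₐ[F] K := AdjoinRoot.liftAlgHom f (Algebra.ofId F K) (-r) (by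
    simp only [f, eval₂_sub, eval₂_pow, eval₂_X, eval₂_C]
    rw [neg_sq, hr]
    exact sub_self _)
  have hσ₀ : σ₀ r = -r := AdjoinRoot.liftAlgHom_root _ _ _ _
  let σ : K ≃ₐ[F] K := AlgEquiv.ofBijective σ₀ (Algebra.IsAlgebraic.algHom_bijective σ₀)
  refine exists_prime_aux hfin (u : 𝓞 F) u.isUnit ⟨r, hrint⟩ ?_ σ hσ₀
  apply RingOfIntegers.ext
  exact hr

/-- For any number field `F` there exists a square-free ideal `q` of the
ring of integers such that every unit that is a square modulo `q` is a square in the unit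
group. -/
theorem exists_squarefree_ideal_units_square_mod_iff_square
    (F : Type*) [Field F] [NumberField F] :
    ∃ q : Ideal (𝓞 F), Squarefree q ∧
      ∀ u : (𝓞 F)ˣ, (∃ v : 𝓞 F, (u : 𝓞 F) - v ^ 2 ∈ q) → ∃ w : (𝓞 F)ˣ, u = w ^ 2 := by
  classical
  let H : Subgroup (𝓞 F)ˣ := (powMonoidHom 2 : (𝓞 F)ˣ →* (𝓞 F)ˣ).range
  have hfg : Group.FG (𝓞 F)ˣ := Group.fg_iff_monoid_fg.2 inferInstance
  have : Finite ((𝓞 F)ˣ ⧸ H) := by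
    have : Group.FG ((𝓞 F)ˣ ⧸ H) := QuotientGroup.fg H
    refine CommGroup.finite_of_fg_torsion _ ?_
    intro x
    obtain ⟨x, rfl⟩ := QuotientGroup.mk_surjective x
    refine isOfFinOrder_iff_pow_eq_one.2 ⟨2, two_pos, ?_⟩
    rw [← QuotientGroup.mk_pow, QuotientGroup.eq_one_iff]
    exact ⟨x, rfl⟩
  have := Fintype.ofFinite ((𝓞 F)ˣ ⧸ H)
  have hex : ∀ c : (𝓞 F)ˣ ⧸ H, ∃ p : Ideal (𝓞 F), c ≠ 1 →
      Prime p ∧ ∀ v : 𝓞 F, ((c.out : (𝓞 F)ˣ) : 𝓞 F) - v ^ 2 ∉ p := by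
    intro c
    by_cases hc : c = 1
    · exact ⟨⊤, fun h => absurd hc h⟩
    · obtain ⟨p, hp⟩ := exists_prime c.out (by
        rintro ⟨w, hw⟩
        apply hc
        rw [← QuotientGroup.out_eq' c, QuotientGroup.eq_one_iff]
        exact ⟨w, hw.symm⟩)
      exact ⟨p.asIdeal, fun _ => ⟨p.prime, hp⟩⟩
  choose p hp using hex
  let T : Finset (Ideal (𝓞 F)) := (Finset.univ.filter (fun c : (𝓞 F)ˣ ⧸ H => c ≠ 1)).image p
  have hT : ∀ P ∈ T, Prime P := by
    intro P hP
    obtain ⟨c, hc, rfl⟩ := Finset.mem_image.1 hP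
    exact (hp c (Finset.mem_filter.1 hc).2).1
  refine ⟨∏ P ∈ T, P, ?_, ?_⟩
  · refine Finset.squarefree_prod_of_pairwise_isCoprime ?_ fun P hP => (hT P hP).squarefree
    intro P hP Q hQ hPQ
    have h1 := (Ideal.isPrime_of_prime (hT P hP)).isMaximal (hT P hP).ne_zero
    have h2 := (Ideal.isPrime_of_prime (hT Q hQ)).isMaximal (hT Q hQ).ne_zero
    exact (Ideal.isCoprime_of_isMaximal hPQ).isRelPrime
  · rintro u ⟨v, hv⟩
    by_cases hc : (QuotientGroup.mk u : (𝓞 F)ˣ ⧸ H) = 1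
    · rw [QuotientGroup.eq_one_iff] at hc
      obtain ⟨w, hw⟩ := hc
      exact ⟨w, hw.symm⟩
    · exfalso
      set c : (𝓞 F)ˣ ⧸ H := QuotientGroup.mk u with hcdef
      have hmem : p c ∈ T := Finset.mem_image.2 ⟨c, by simpa using hc, rfl⟩
      have hvp : (u : 𝓞 F) - v ^ 2 ∈ p c := by
        have hdvd : p c ∣ ∏ P ∈ T, P := Finset.dvd_prod_of_mem _ hmem
        exact Ideal.le_of_dvd hdvd hv
      obtain ⟨⟨h, w, hw⟩, hh⟩ := QuotientGroup.mk_out_eq_mul H u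
      apply (hp c hc).2 (v * w)
      have : ((c.out : (𝓞 F)ˣ) : 𝓞 F) - (v * w) ^ 2 = ((u : 𝓞 F) - v ^ 2) * (w : 𝓞 F) ^ 2 := by
        rw [hcdef, hh]
        simp only [powMonoidHom_apply] at hw
        subst hw
        push_cast
        ring
      rw [this]
      exact Ideal.mul_mem_right _ _ hvp
end

section
/- Let F be a number field of degree n and let M(L,2,δ) count matrices γ = (a b; c d) ∈ GL_2(F) with entries satisfying: a,d ∈ O_F, a − d ∈ q, bc ∈ q, det γ = (l₁l₂)² with l₁, l₂ totally positive generators of split principal primes coprime to q with archimedean sizes ≍ L^{2/n} per place, and γ nonparabolic (i.e., (a+d)² ≠ 4 det γ), where q is a fixed ideal with the property that every unit that is a square mod q is a square, and N(q) exceeds a sufficiently large constant depending on F. Suppose further that at each archimedean place v, |a_v + d_v| ≤ C·|l₁l₂|_v and |Im((a_v+d_v)/(l₁l₂)_v)| ≤ C·√δ_v. Let K be the maximal totally real subfield of F and m = [F:K]. Then either 1 ≪ L^{8(m−1)}·∏_{v complex} δ_v², or no such matrix exists. -/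
open scoped Classical

open NumberField

lemma aux_denom_ideal {E F : Type*} [Field E] [NumberField E] [Field F] [NumberField F]
    [Algebra E F] (x y : 𝓞 E) (hy : y ≠ 0) (s t : 𝓞 F)
    (h : s * algebraMap (𝓞 E) (𝓞 F) x = t * algebraMap (𝓞 E) (𝓞 F) y) :
    ∃ D : Ideal (𝓞 E), D.map (algebraMap (𝓞 E) (𝓞 F)) ∣ Ideal.span {s} ∧ (D = ⊤ → y ∣ x) := by
  set I : Ideal (𝓞 E) := Ideal.span {x} ⊔ Ideal.span {y} with hI
  obtain ⟨A, hA⟩ : I ∣ Ideal.span {x} := Ideal.dvd_iff_le.mpr le_sup_left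
  obtain ⟨D, hD⟩ : I ∣ Ideal.span {y} := Ideal.dvd_iff_le.mpr le_sup_right
  have hI0 : I ≠ 0 := by
    intro h0
    rw [h0, zero_mul] at hD
    exact hy (by simpa using hD)
  have hAD : A ⊔ D = ⊤ := by
    have : I * (A ⊔ D) = I * ⊤ := by
      rw [Ideal.mul_sup, ← hA, ← hD, ← hI, Ideal.mul_top]
    exact mul_left_cancel₀ hI0 this
  refine ⟨D, ?_, ?_⟩
  · have hinj := FaithfulSMul.algebraMap_injective (𝓞 E) (𝓞 F)
    have hI0' : I.map (algebraMap (𝓞 E) (𝓞 F)) ≠ 0 :=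
      (Ideal.map_eq_bot_iff_of_injective hinj).not.mpr hI0
    have h1 : Ideal.span {s} * (I.map (algebraMap (𝓞 E) (𝓞 F)) * A.map (algebraMap (𝓞 E) (𝓞 F)))
        = Ideal.span {t} * (I.map (algebraMap (𝓞 E) (𝓞 F)) * D.map (algebraMap (𝓞 E) (𝓞 F))) := by
      rw [← Ideal.map_mul, ← Ideal.map_mul, ← hA, ← hD, Ideal.map_span, Ideal.map_span]
      simp only [Set.image_singleton, Ideal.span_singleton_mul_span_singleton, h]
    have h2 : Ideal.span {s} * A.map (algebraMap (𝓞 E) (𝓞 F))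
        = Ideal.span {t} * D.map (algebraMap (𝓞 E) (𝓞 F)) := by
      apply mul_left_cancel₀ hI0'
      rw [mul_left_comm, h1, mul_left_comm]
    have hco : IsCoprime (D.map (algebraMap (𝓞 E) (𝓞 F))) (A.map (algebraMap (𝓞 E) (𝓞 F))) := by
      rw [Ideal.isCoprime_iff_sup_eq, ← Ideal.map_sup, sup_comm, hAD, Ideal.map_top]
    exact hco.dvd_of_dvd_mul_right ⟨_, by rw [h2, mul_comm]⟩
  · rintro rfl
    rw [Ideal.mul_top] at hD
    have : x ∈ Ideal.span {y} := by
      rw [hD]; exact Ideal.mem_sup_left (Ideal.mem_span_singleton_self x)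
    exact Ideal.mem_span_singleton.mp this

/-- subfield case: integral or small. -/
lemma aux_subfield {E F : Type*} [Field E] [NumberField E] [Field F] [NumberField F]
    [Algebra E F] (hk : 1 < Module.finrank E F) (ξ : E)
    (l₁ l₂ : 𝓞 F) (p₁ p₂ : ℕ) (hp₁ : p₁.Prime) (hp₂ : p₂.Prime)
    (h₁ : Ideal.absNorm (Ideal.span {l₁}) = p₁)
    (h₂ : Ideal.absNorm (Ideal.span {l₂}) = p₂)
    (h12 : Ideal.span {l₁} ≠ Ideal.span {l₂} → p₁ ≠ p₂)
    (t : 𝓞 F)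
    (ht : algebraMap (𝓞 F) F t = algebraMap (𝓞 F) F (l₁ * l₂) * algebraMap E F ξ) :
    (∃ r : 𝓞 E, algebraMap (𝓞 E) E r = ξ) ∨
      (p₁ = p₂ ∧ p₁ ≤ (discr F).natAbs) := by
  obtain ⟨x, y, hy, rfl⟩ := IsFractionRing.div_surjective (A := 𝓞 E) ξ
  have hy0 : y ≠ 0 := nonZeroDivisors.ne_zero hy
  have hyE : algebraMap (𝓞 E) E y ≠ 0 := by simpa using hy0
  have hyF : algebraMap E F (algebraMap (𝓞 E) E y) ≠ 0 := by simpa using hy0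
  obtain ⟨D, hD, hDtop⟩ := aux_denom_ideal x y hy0 (l₁ * l₂) t (by
    apply FaithfulSMul.algebraMap_injective (𝓞 F) F
    rw [map_mul, map_mul (algebraMap (𝓞 F) F) t, ht, ← IsScalarTower.algebraMap_apply (𝓞 E) (𝓞 F) F,
      ← IsScalarTower.algebraMap_apply (𝓞 E) (𝓞 F) F, IsScalarTower.algebraMap_apply (𝓞 E) E F,
      IsScalarTower.algebraMap_apply (𝓞 E) E F, map_div₀]
    field_simp)
  by_cases hDt : D = ⊤
  · left
    obtain ⟨r, hr⟩ := hDtop hDt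
    refine ⟨r, ?_⟩
    rw [hr, map_mul]
    field_simp
  right
  have hN1 : Ideal.absNorm D ≠ 1 := by rwa [Ne, Ideal.absNorm_eq_one_iff]
  have hfin : Module.finrank (𝓞 E) (𝓞 F) = Module.finrank E F :=
    (IsFractionRing.finrank_eq (𝓞 E) E (𝓞 F) F).symm
  have hdvd : Ideal.absNorm D ^ Module.finrank E F ∣ p₁ * p₂ := by
    have := map_dvd Ideal.absNorm hD
    rwa [Ideal.absNorm_algebraMap, hfin, ← Ideal.span_singleton_mul_span_singleton, map_mul,
      h₁, h₂] at this
  have hdvd2 : Ideal.absNorm D ^ 2 ∣ p₁ * p₂ := (pow_dvd_pow _ hk).trans hdvd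
  have heq : p₁ = p₂ := by
    by_contra hne
    have hsq : Squarefree (p₁ * p₂) := by
      rw [Nat.squarefree_mul ((Nat.coprime_primes hp₁ hp₂).mpr hne)]
      exact ⟨hp₁.prime.squarefree, hp₂.prime.squarefree⟩
    have := hsq (Ideal.absNorm D) (by rwa [← sq])
    exact hN1 (Nat.isUnit_iff.mp this)
  refine ⟨heq, ?_⟩
  have hspan : Ideal.span {l₁} = Ideal.span {l₂} := by
    by_contra h; exact h12 h heq
  subst heq
  have hNp : Ideal.absNorm D = p₁ := by
    have : Ideal.absNorm D ∣ p₁ := by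
      rw [← sq] at hdvd2
      exact (Nat.pow_dvd_pow_iff (two_ne_zero)).mp hdvd2
    exact ((Nat.dvd_prime hp₁).mp this).resolve_left hN1
  have hmapdvd : Ideal.span {l₁} ^ 2 ∣ D.map (algebraMap (𝓞 E) (𝓞 F)) := by
    have hD' : D.map (algebraMap (𝓞 E) (𝓞 F)) ∣ Ideal.span {l₁} ^ 2 := by
      rwa [← Ideal.span_singleton_mul_span_singleton, ← hspan, ← sq] at hD
    obtain ⟨J, hJ⟩ := hD'
    have hn := congrArg Ideal.absNorm hJ
    rw [map_pow, h₁, map_mul, Ideal.absNorm_algebraMap, hfin, hNp] at hn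
    have hle : p₁ ^ 2 ≤ p₁ ^ Module.finrank E F := Nat.pow_le_pow_right hp₁.pos hk
    have hJ1 : Ideal.absNorm J = 1 := by
      have hpos : 0 < p₁ ^ 2 := pow_pos hp₁.pos 2
      have : Ideal.absNorm J ≤ 1 := by
        by_contra hcon
        push Not at hcon
        nlinarith
      have h0 : Ideal.absNorm J ≠ 0 := by
        intro h0
        rw [h0, mul_zero] at hn
        omega
      omega
    rw [Ideal.absNorm_eq_one_iff] at hJ1
    rw [hJ, hJ1, Ideal.mul_top]
  have hpD : (Ideal.span {(p₁ : ℤ)}).map (algebraMap ℤ (𝓞 F)) ≤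
      D.map (algebraMap (𝓞 E) (𝓞 F)) := by
    rw [Ideal.map_span, Set.image_singleton, Ideal.span_singleton_le_iff_mem]
    have := Ideal.mem_map_of_mem (algebraMap (𝓞 E) (𝓞 F)) (Ideal.absNorm_mem D)
    simpa [hNp] using this
  have hdiv : Ideal.span {l₁} ^ 2 ∣ (Ideal.span {(p₁ : ℤ)}).map (algebraMap ℤ (𝓞 F)) :=
    hmapdvd.trans (Ideal.dvd_iff_le.mpr hpD)
  have hprime : Prime (p₁ : ℤ) := Nat.prime_iff_prime_int.mp hp₁
  have : (Ideal.span {(p₁ : ℤ)}).IsMaximal :=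
    PrincipalIdealRing.isMaximal_of_irreducible hprime.irreducible
  have hdiff := pow_sub_one_dvd_differentIdeal ℤ (p := Ideal.span {(p₁ : ℤ)})
    (Ideal.span {l₁}) 2 (by simpa using hp₁.ne_zero) hdiv
  have := map_dvd Ideal.absNorm hdiff
  rw [NumberField.absNorm_differentIdeal F] at this
  simp only [Nat.add_one_sub_one, pow_one, h₁] at this
  exact Nat.le_of_dvd (Int.natAbs_pos.mpr (discr_ne_zero F)) this

lemma aux_norm_bound {F : Type*} [Field F] [NumberField F] (z s : F) (B : ℝ)
    (h : ∀ v : InfinitePlace F, v z ≤ B * v s) :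
    ((|Algebra.norm ℚ z| : ℚ) : ℝ) ≤ B ^ Module.finrank ℚ F * ((|Algebra.norm ℚ s| : ℚ) : ℝ) := by
  rw [← InfinitePlace.prod_eq_abs_norm, ← InfinitePlace.prod_eq_abs_norm,
    ← InfinitePlace.sum_mult_eq, ← Finset.prod_pow_eq_pow_sum, ← Finset.prod_mul_distrib]
  refine Finset.prod_le_prod (fun v _ => pow_nonneg (apply_nonneg _ _) _) (fun v _ => ?_)
  rw [← mul_pow]
  exact pow_le_pow_left₀ (apply_nonneg _ _) (h v) _

lemma aux_absNorm_cast {F : Type*} [Field F] [NumberField F] (z : 𝓞 F) :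
    (Ideal.absNorm (Ideal.span {z}) : ℝ) = ((|Algebra.norm ℚ (algebraMap (𝓞 F) F z)| : ℚ) : ℝ) := by
  rw [Ideal.absNorm_span_singleton]
  have := Algebra.coe_norm_int z
  rw [← this]
  push_cast
  rw [Nat.cast_natAbs]
  push_cast
  rfl

lemma aux_q_le {F : Type*} [Field F] [NumberField F] (q : Ideal (𝓞 F)) (z s : 𝓞 F) (B : ℝ)
    (hz : z ∈ q) (hz0 : z ≠ 0)
    (h : ∀ v : InfinitePlace F, v (algebraMap (𝓞 F) F z) ≤ B * v (algebraMap (𝓞 F) F s)) :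
    (Ideal.absNorm q : ℝ) ≤ B ^ Module.finrank ℚ F * (Ideal.absNorm (Ideal.span {s}) : ℝ) := by
  rw [aux_absNorm_cast]
  refine le_trans ?_ (aux_norm_bound _ _ _ h)
  rw [← aux_absNorm_cast]
  have hd : Ideal.absNorm q ∣ Ideal.absNorm (Ideal.span {z}) :=
    map_dvd Ideal.absNorm (Ideal.dvd_iff_le.mpr ((Ideal.span_singleton_le_iff_mem _).mpr hz))
  refine Nat.cast_le.mpr (Nat.le_of_dvd ?_ hd)
  rw [Nat.pos_iff_ne_zero, Ne, Ideal.absNorm_eq_zero_iff]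
  simpa using hz0

lemma aux_deriv {K F Ω : Type*} [Field K] [Field F] [Field Ω] [CharZero K] [Algebra K F]
    [FiniteDimensional K F] [IsAlgClosed Ω] [Algebra K Ω] (ξ : F)
    (hξ : IntermediateField.adjoin K {ξ} = ⊤) (σ : F →ₐ[K] Ω) :
    σ (Polynomial.aeval ξ (Polynomial.derivative (minpoly K ξ))) =
      ∏ τ ∈ Finset.univ.erase σ, (σ ξ - τ ξ) := by
  have hint : IsIntegral K ξ := Algebra.IsIntegral.isIntegral ξ
  set f := (minpoly K ξ).map (algebraMap K Ω) with hf
  have hf0 : f ≠ 0 := ((minpoly.monic hint).map _).ne_zero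
  have hinj : Function.Injective (fun τ : F →ₐ[K] Ω => τ ξ) := by
    intro τ₁ τ₂ h
    refine AlgHom.ext_of_adjoin_eq_top (s := ({ξ} : Set F)) ?_ (by simpa using h)
    rw [← IntermediateField.adjoin_simple_toSubalgebra_of_isAlgebraic hint.isAlgebraic, hξ,
      IntermediateField.top_toSubalgebra]
  have hroots : f.roots = (Finset.univ : Finset (F →ₐ[K] Ω)).val.map (fun τ => τ ξ) := by
    rw [Multiset.Nodup.ext]
    · intro z
      rw [Polynomial.mem_roots hf0, Multiset.mem_map]
      constructor
      · intro hz
        have hz' : z ∈ (minpoly K ξ).aroots Ω := by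
          rw [Polynomial.aroots, Polynomial.mem_roots hf0]; exact hz
        obtain ⟨τ, hτ⟩ : z ∈ Set.range (fun τ : F →ₐ[K] Ω => τ ξ) := by
          rw [Algebra.IsAlgebraic.range_eval_eq_rootSet_minpoly]
          rw [Polynomial.mem_rootSet']
          exact ⟨hf0, by simpa [hf, Polynomial.IsRoot, Polynomial.eval_map_algebraMap] using hz⟩
        exact ⟨τ, Finset.mem_univ _, hτ⟩
      · rintro ⟨τ, -, rfl⟩
        rw [Polynomial.IsRoot, hf, Polynomial.eval_map_algebraMap, Polynomial.aeval_algHom_apply,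
          minpoly.aeval, map_zero]
    · exact Polynomial.nodup_roots (Polynomial.Separable.map (Algebra.IsSeparable.isSeparable K ξ))
    · exact (Multiset.nodup_map_iff_of_injective hinj).mpr Finset.univ.nodup
  have hmem : σ ξ ∈ f.roots := by
    rw [hroots]; exact Multiset.mem_map_of_mem _ (Finset.mem_univ_val σ)
  have := (IsAlgClosed.splits f).eval_root_derivative ((minpoly.monic hint).map _) hmem
  rw [hf, Polynomial.derivative_map, Polynomial.eval_map_algebraMap,
    Polynomial.aeval_algHom_apply] at this
  rw [this, ← hf, hroots]
  have h2 : (Multiset.map (fun τ : F →ₐ[K] Ω => τ ξ) Finset.univ.val).erase (σ ξ) =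
      Multiset.map (fun τ : F →ₐ[K] Ω => τ ξ) (Finset.univ.erase σ).val := by
    rw [Finset.erase_val, Multiset.map_erase _ hinj]
  rw [h2, Multiset.map_map]
  rfl

lemma aux_integral {K F : Type*} [Field K] [Field F] [CharZero K] [Algebra K F]
    [NumberField F] [FiniteDimensional K F] (ξ : F)
    (hξ : IntermediateField.adjoin K {ξ} = ⊤) (ℓ η : 𝓞 F) (hℓ : ℓ ≠ 0)
    (h : algebraMap (𝓞 F) F η = algebraMap (𝓞 F) F ℓ * ξ) :
    IsIntegral ℤ ((algebraMap (𝓞 F) F ℓ) ^ (Module.finrank K F - 1) * (algebraMap (𝓞 F) F ℓ)⁻¹ *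
      algebraMap K F (Algebra.norm K (algebraMap (𝓞 F) F ℓ)) *
      (Polynomial.aeval ξ (Polynomial.derivative (minpoly K ξ)))) := by
  obtain ⟨σ₀⟩ : Nonempty (F →+* ℂ) := inferInstance
  let _ : Algebra K ℂ := (σ₀.comp (algebraMap K F)).toAlgebra
  let σ : F →ₐ[K] ℂ := { σ₀ with commutes' := fun _ => rfl }
  have hℓ' : (algebraMap (𝓞 F) F ℓ) ≠ 0 := by simpa using hℓ
  have hℓ0 : σ (algebraMap (𝓞 F) F ℓ) ≠ 0 := by simpa using hℓ
  have hi : Function.Injective (σ.toRingHom.toIntAlgHom) := σ.toRingHom.injective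
  rw [← isIntegral_algHom_iff _ hi]
  change IsIntegral ℤ (σ _)
  rw [map_mul, aux_deriv ξ hξ σ, map_mul, map_mul, map_pow, map_inv₀, AlgHom.commutes,
    Algebra.norm_eq_prod_embeddings K ℂ, ← Finset.mul_prod_erase _ _ (Finset.mem_univ σ)]
  have hcard : (Finset.univ.erase σ).card = Module.finrank K F - 1 := by
    rw [Finset.card_erase_of_mem (Finset.mem_univ _), Finset.card_univ, AlgHom.card K F ℂ]
  have : σ (algebraMap (𝓞 F) F ℓ) ^ (Module.finrank K F - 1) * (σ (algebraMap (𝓞 F) F ℓ))⁻¹ *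
      (σ (algebraMap (𝓞 F) F ℓ) * ∏ τ ∈ Finset.univ.erase σ, τ (algebraMap (𝓞 F) F ℓ)) *
      ∏ τ ∈ Finset.univ.erase σ, (σ ξ - τ ξ) =
      ∏ τ ∈ Finset.univ.erase σ, (τ (algebraMap (𝓞 F) F ℓ) * σ (algebraMap (𝓞 F) F η) -
        σ (algebraMap (𝓞 F) F ℓ) * τ (algebraMap (𝓞 F) F η)) := by
    have e1 : ∀ τ ∈ Finset.univ.erase σ, (τ (algebraMap (𝓞 F) F ℓ) * σ (algebraMap (𝓞 F) F η) -
        σ (algebraMap (𝓞 F) F ℓ) * τ (algebraMap (𝓞 F) F η)) =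
        σ (algebraMap (𝓞 F) F ℓ) * (τ (algebraMap (𝓞 F) F ℓ) * (σ ξ - τ ξ)) := by
      intro τ _
      rw [h, map_mul, map_mul]
      ring
    rw [Finset.prod_congr rfl e1, Finset.prod_mul_distrib, Finset.prod_mul_distrib,
      Finset.prod_const, hcard]
    field_simp
  rw [this]
  have hI : ∀ (τ : F →ₐ[K] ℂ) (z : 𝓞 F), IsIntegral ℤ (τ (algebraMap (𝓞 F) F z)) :=
    fun τ z => z.isIntegral_coe.map (τ.toRingHom.toIntAlgHom)
  exact IsIntegral.prod _ (fun τ _ => ((hI τ ℓ).mul (hI σ η)).sub ((hI σ ℓ).mul (hI τ η)))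

lemma aux_place_bound {K F : Type*} [Field K] [Field F] [CharZero K] [Algebra K F]
    [NumberField F] [FiniteDimensional K F]
    (hreal : ∀ (k : K) (φ : F →+* ℂ), (φ (algebraMap K F k)).im = 0) (ξ : F)
    (hξ : IntermediateField.adjoin K {ξ} = ⊤) (C : ℝ) (hC : 0 < C) (δ : InfinitePlace F → ℝ)
    (hb : ∀ v : InfinitePlace F, v ξ ≤ C)
    (him : ∀ v : InfinitePlace F, |(v.embedding ξ).im| ≤ C * Real.sqrt (δ v))
    (v : InfinitePlace F) :
    v (Polynomial.aeval ξ (Polynomial.derivative (minpoly K ξ))) ≤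
      (2 * C) ^ (Module.finrank K F - 1) * (if v.IsReal then 1 else Real.sqrt (δ v)) := by
  let _ : Algebra K ℂ := (v.embedding.comp (algebraMap K F)).toAlgebra
  let σ : F →ₐ[K] ℂ := { v.embedding with commutes' := fun _ => rfl }
  have hσ : ∀ x, σ x = v.embedding x := fun _ => rfl
  have hcard : (Finset.univ.erase σ).card = Module.finrank K F - 1 := by
    rw [Finset.card_erase_of_mem (Finset.mem_univ _), Finset.card_univ, AlgHom.card K F ℂ]
  have hτ : ∀ τ : F →ₐ[K] ℂ, ‖τ ξ‖ ≤ C := by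
    intro τ
    have := hb (InfinitePlace.mk τ.toRingHom)
    rw [InfinitePlace.apply] at this
    exact this
  have hd : ∀ τ : F →ₐ[K] ℂ, ‖σ ξ - τ ξ‖ ≤ 2 * C := fun τ =>
    (norm_sub_le _ _).trans (by linarith [hτ σ, hτ τ])
  rw [← InfinitePlace.norm_embedding_eq, ← hσ, aux_deriv ξ hξ σ, norm_prod]
  split_ifs with hv
  · rw [mul_one, ← hcard, ← Finset.prod_const]
    exact Finset.prod_le_prod (fun _ _ => norm_nonneg _) (fun τ _ => hd τ)
  · let σc : F →ₐ[K] ℂ := { ComplexEmbedding.conjugate v.embedding with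
      commutes' := fun k => Complex.conj_eq_iff_im.mpr (hreal k v.embedding) }
    have hne : σc ≠ σ := by
      intro h
      apply hv
      rw [InfinitePlace.isReal_iff]
      ext x
      exact DFunLike.congr_fun h x
    have hmem : σc ∈ Finset.univ.erase σ := Finset.mem_erase.mpr ⟨hne, Finset.mem_univ _⟩
    rw [← Finset.mul_prod_erase _ _ hmem]
    have hcard2 : ((Finset.univ.erase σ).erase σc).card + 1 = Module.finrank K F - 1 := by
      rw [← hcard, Finset.card_erase_add_one hmem]
    have h1 : ‖σ ξ - σc ξ‖ ≤ 2 * C * Real.sqrt (δ v) := by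
      have : σ ξ - σc ξ = ((2 * (v.embedding ξ).im : ℝ) : ℂ) * Complex.I := by
        change v.embedding ξ - (starRingEnd ℂ) (v.embedding ξ) = _
        rw [Complex.sub_conj]
      rw [this, norm_mul, Complex.norm_I, mul_one, Complex.norm_real, Real.norm_eq_abs, abs_mul,
        abs_two]
      linarith [him v]
    have h2 : ∏ τ ∈ (Finset.univ.erase σ).erase σc, ‖σ ξ - τ ξ‖ ≤
        (2 * C) ^ ((Finset.univ.erase σ).erase σc).card := by
      rw [← Finset.prod_const]
      exact Finset.prod_le_prod (fun _ _ => norm_nonneg _) (fun τ _ => hd τ)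
    calc _ ≤ (2 * C * Real.sqrt (δ v)) * (2 * C) ^ ((Finset.univ.erase σ).erase σc).card :=
          mul_le_mul h1 h2 (Finset.prod_nonneg fun _ _ => norm_nonneg _) (by positivity)
      _ = _ := by rw [← hcard2]; ring

lemma aux_rigidity {K F : Type*} [Field K] [NumberField K] [Field F] [Algebra K F]
    [NumberField F]
    (hreal : ∀ (k : K) (φ : F →+* ℂ), (φ (algebraMap K F k)).im = 0) (ξ : F)
    (hξ : IntermediateField.adjoin K {ξ} = ⊤) (C : ℝ) (hC : 0 < C) (δ : InfinitePlace F → ℝ)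
    (hδ : ∀ v, 0 < δ v)
    (hb : ∀ v : InfinitePlace F, v ξ ≤ C)
    (him : ∀ v : InfinitePlace F, |(v.embedding ξ).im| ≤ C * Real.sqrt (δ v))
    (ℓ η : 𝓞 F) (hℓ : ℓ ≠ 0)
    (h : algebraMap (𝓞 F) F η = algebraMap (𝓞 F) F ℓ * ξ) :
    1 ≤ ((|Algebra.norm ℚ (algebraMap (𝓞 F) F ℓ)| : ℚ) : ℝ) ^ (2 * (Module.finrank K F - 1)) *
      (((2 * C) ^ (Module.finrank K F - 1)) ^ (Module.finrank ℚ F) *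
      ∏ v ∈ Finset.univ.filter (fun v : InfinitePlace F => ¬ v.IsReal), δ v) := by
  have hℓ' : (algebraMap (𝓞 F) F ℓ) ≠ 0 := by simpa using hℓ
  have hN0 : Algebra.norm ℚ (algebraMap (𝓞 F) F ℓ) ≠ 0 := Algebra.norm_ne_zero_iff.mpr hℓ'
  have hm : 0 < Module.finrank K F := Module.finrank_pos
  set g := Polynomial.aeval ξ (Polynomial.derivative (minpoly K ξ)) with hg
  have hg0 : g ≠ 0 := (Algebra.IsSeparable.isSeparable K ξ).aeval_derivative_ne_zero
    (minpoly.aeval K ξ)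
  set γ := ((algebraMap (𝓞 F) F ℓ) ^ (Module.finrank K F - 1) * (algebraMap (𝓞 F) F ℓ)⁻¹ *
      algebraMap K F (Algebra.norm K (algebraMap (𝓞 F) F ℓ)) * g) with hγ
  have hint : IsIntegral ℤ γ := aux_integral ξ hξ ℓ η hℓ h
  have hγ0 : γ ≠ 0 := by
    refine mul_ne_zero (mul_ne_zero (mul_ne_zero (pow_ne_zero _ hℓ') (inv_ne_zero hℓ')) ?_) hg0
    simpa [Algebra.norm_ne_zero_iff] using hℓ
  have hNγ : Algebra.norm ℚ γ = (Algebra.norm ℚ (algebraMap (𝓞 F) F ℓ)) ^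
      (2 * (Module.finrank K F - 1)) * Algebra.norm ℚ g := by
    have e : Algebra.norm ℚ (algebraMap K F (Algebra.norm K (algebraMap (𝓞 F) F ℓ))) =
        (Algebra.norm ℚ (algebraMap (𝓞 F) F ℓ)) ^ (Module.finrank K F) := by
      rw [← Algebra.norm_norm (R := ℚ) (S := K), Algebra.norm_algebraMap, map_pow,
        Algebra.norm_norm]
    have einv : Algebra.norm ℚ (algebraMap (𝓞 F) F ℓ)⁻¹ =
        (Algebra.norm ℚ (algebraMap (𝓞 F) F ℓ))⁻¹ := by
      apply eq_inv_of_mul_eq_one_left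
      rw [← map_mul, inv_mul_cancel₀ hℓ', map_one]
    rw [hγ, map_mul, map_mul, map_mul, map_pow, einv, e]
    obtain ⟨k, hk⟩ : ∃ k, Module.finrank K F = k + 1 := ⟨_, (Nat.succ_pred_eq_of_pos hm).symm⟩
    rw [hk]
    simp only [Nat.add_sub_cancel]
    field_simp
    ring
  have h1 : (1 : ℝ) ≤ ((|Algebra.norm ℚ γ| : ℚ) : ℝ) := by
    obtain ⟨γ', hγ'⟩ : ∃ γ' : 𝓞 F, algebraMap (𝓞 F) F γ' = γ := ⟨⟨γ, hint⟩, rfl⟩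
    rw [← hγ', ← aux_absNorm_cast]
    refine Nat.one_le_cast.mpr (Nat.pos_iff_ne_zero.mpr ?_)
    rw [Ne, Ideal.absNorm_eq_zero_iff, Ideal.span_singleton_eq_bot]
    intro h0
    rw [h0, map_zero] at hγ'
    exact hγ0 hγ'.symm
  rw [hNγ, abs_mul, abs_pow] at h1
  push_cast at h1 ⊢
  refine h1.trans (mul_le_mul_of_nonneg_left ?_ (by positivity))
  rw [← Rat.cast_abs, ← InfinitePlace.prod_eq_abs_norm, ← InfinitePlace.sum_mult_eq,
    ← Finset.prod_pow_eq_pow_sum, Finset.prod_filter, ← Finset.prod_mul_distrib]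
  refine Finset.prod_le_prod (fun v _ => pow_nonneg (apply_nonneg _ _) _) (fun v _ => ?_)
  refine (pow_le_pow_left₀ (apply_nonneg _ _)
    (aux_place_bound hreal ξ hξ C hC δ hb him v) _).trans ?_
  rw [mul_pow]
  refine mul_le_mul_of_nonneg_left ?_ (by positivity)
  by_cases hv : v.IsReal
  · simp [hv]
  · simp only [hv, if_false, not_false_eq_true, if_true, InfinitePlace.mult]
    rw [Real.sq_sqrt (hδ v).le]

/-- (The key rigidity-based estimate for nonparabolic matrices with
square determinant.) Let `F` be a number field with maximal totally real subfield `K`,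
`m = [F : K]`. Fix an implied constant `C > 0`. There are constants `C₀, C' > 0`
(depending only on `F` and `C`) such that: for any ideal `q` of `𝓞 F` with the property
that every unit which is a square modulo `q` is a square, and with `N(q) ≥ C₀`; for any
`L ≥ 1` and totally positive generators `l₁, l₂` of split principal primes coprime to `q`
(with distinct ideals lying over distinct rational primes) with `|l₁l₂|_v ≍_C L^{2/n}` at
each archimedean place; and for any matrix data `a, d ∈ 𝓞 F`, `b, c ∈ F` with
`a - d ∈ q`, `bc ∈ q` (as an integer), `ad - bc = (l₁l₂)²`, nonparabolic
(`(a+d)² ≠ 4(l₁l₂)²`), and satisfying `|a_v + d_v| ≤ C|l₁l₂|_v` and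
`|Im((a+d)/(l₁l₂))_v| ≤ C√δ_v` at every archimedean place `v` (with `δ_v > 0`) —
one has `1 ≤ C' · L^{8(m-1)} · ∏_{v complex} δ_v²`. -/
theorem nonparabolic_square_determinant_rigidity
    (F : Type*) [Field F] [NumberField F]
    (K : IntermediateField ℚ F)
    (hK : ∀ x : F, x ∈ K ↔ ∀ φ : F →+* ℂ, (φ x).im = 0)
    (C : ℝ) (hC : 0 < C) :
    ∃ C₀ C' : ℝ, 0 < C₀ ∧ 0 < C' ∧
      ∀ (q : Ideal (𝓞 F)),
        (∀ u : (𝓞 F)ˣ, (∃ w : 𝓞 F, (u : 𝓞 F) - w ^ 2 ∈ q) → IsSquare u) →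
        C₀ ≤ (Ideal.absNorm q : ℝ) →
      ∀ (L : ℝ), 1 ≤ L →
      ∀ (l₁ l₂ : 𝓞 F) (p₁ p₂ : ℕ), p₁.Prime → p₂.Prime →
        (Ideal.span {l₁}).IsPrime → (Ideal.span {l₂}).IsPrime →
        Ideal.absNorm (Ideal.span {l₁}) = p₁ →
        Ideal.absNorm (Ideal.span {l₂}) = p₂ →
        (Ideal.span {l₁} ≠ Ideal.span {l₂} → p₁ ≠ p₂) →
        IsCoprime (Ideal.span {l₁}) q → IsCoprime (Ideal.span {l₂}) q →
        (∀ l ∈ ({l₁, l₂} : Set (𝓞 F)), ∀ v : InfinitePlace F, v.IsReal →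
          0 < (v.embedding (algebraMap (𝓞 F) F l)).re) →
        (∀ v : InfinitePlace F,
          v (algebraMap (𝓞 F) F (l₁ * l₂)) ≤ C * L ^ ((2 : ℝ) / (Module.finrank ℚ F)) ∧
          L ^ ((2 : ℝ) / (Module.finrank ℚ F)) ≤ C * v (algebraMap (𝓞 F) F (l₁ * l₂))) →
      ∀ (δ : InfinitePlace F → ℝ), (∀ v, 0 < δ v) →
      ∀ (a d : 𝓞 F) (b c : F),
        a - d ∈ q →
        (∃ e : 𝓞 F, algebraMap (𝓞 F) F e = b * c ∧ e ∈ q) →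
        algebraMap (𝓞 F) F a * algebraMap (𝓞 F) F d - b * c =
          (algebraMap (𝓞 F) F (l₁ * l₂)) ^ 2 →
        (algebraMap (𝓞 F) F (a + d)) ^ 2 ≠ 4 * (algebraMap (𝓞 F) F (l₁ * l₂)) ^ 2 →
        (∀ v : InfinitePlace F, v (algebraMap (𝓞 F) F (a + d)) ≤
          C * v (algebraMap (𝓞 F) F (l₁ * l₂))) →
        (∀ v : InfinitePlace F,
          |(v.embedding (algebraMap (𝓞 F) F (a + d) /
            algebraMap (𝓞 F) F (l₁ * l₂))).im| ≤ C * Real.sqrt (δ v)) →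
        1 ≤ C' * L ^ (8 * (Module.finrank K F - 1)) *
          ∏ v ∈ Finset.univ.filter (fun v : InfinitePlace F => ¬ v.IsReal), (δ v) ^ 2 := by
  set n := Module.finrank ℚ F with hn
  have hnpos : 0 < n := Module.finrank_pos
  set m := Module.finrank K F with hm
  set B : ℝ := (C ^ n) ^ (2 * (m - 1)) * ((2 * C) ^ (m - 1)) ^ n with hB
  set A : ℝ := (C ^ 2 + 4) ^ n with hA
  set Δ : ℝ := ((discr F).natAbs : ℝ) with hΔ
  have hApos : 0 < A := by positivity
  have hBpos : 0 < B := by positivity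
  have hΔ0 : 0 ≤ Δ := Nat.cast_nonneg _
  refine ⟨A * Δ ^ 4 + A + 1, B ^ 2, by positivity, by positivity, ?_⟩
  intro q _ hq L hL l₁ l₂ p₁ p₂ hp₁ hp₂ _ _ hN₁ hN₂ h12 hc₁ hc₂ _ hsize δ hδ a d b c had hbc hdet
    hnp htr him
  have hl₁ : l₁ ≠ 0 := by
    rintro rfl
    simp at hN₁
    exact hp₁.ne_zero hN₁.symm
  have hl₂ : l₂ ≠ 0 := by
    rintro rfl
    simp at hN₂
    exact hp₂.ne_zero hN₂.symm
  have hℓ : l₁ * l₂ ≠ 0 := mul_ne_zero hl₁ hl₂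
  have hℓF : algebraMap (𝓞 F) F (l₁ * l₂) ≠ 0 := by
    rw [Ne, FaithfulSMul.algebraMap_eq_zero_iff]; exact hℓ
  set ξ : F := algebraMap (𝓞 F) F (a + d) / algebraMap (𝓞 F) F (l₁ * l₂) with hξ
  have hη : algebraMap (𝓞 F) F (a + d) = algebraMap (𝓞 F) F (l₁ * l₂) * ξ := by
    rw [hξ]; field_simp
  have hvξ : ∀ v : InfinitePlace F, v ξ ≤ C := by
    intro v
    rw [hξ, map_div₀, div_le_iff₀ (InfinitePlace.pos_iff.mpr hℓF)]
    exact htr v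
  by_cases hgen : IntermediateField.adjoin K {ξ} = ⊤
  · -- the generating case
    have hmain := aux_rigidity (K := K) (fun k φ => (hK k).mp k.2 φ) ξ hgen C hC δ hδ hvξ him
      (l₁ * l₂) (a + d) hℓ hη
    set N : ℝ := ((|Algebra.norm ℚ (algebraMap (𝓞 F) F (l₁ * l₂))| : ℚ) : ℝ) with hN
    have hN0 : 0 ≤ N := by rw [hN]; positivity
    have hNle : N ≤ C ^ n * L ^ 2 := by
      have e : C ^ n * L ^ 2 = (C * L ^ ((2 : ℝ) / n)) ^ n := by
        rw [mul_pow, ← Real.rpow_natCast (L ^ ((2 : ℝ) / n)) n, ← Real.rpow_mul (by linarith),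
          div_mul_cancel₀ _ (by positivity), Real.rpow_two]
      rw [e, hN, ← InfinitePlace.prod_eq_abs_norm, hn, ← InfinitePlace.sum_mult_eq,
        ← Finset.prod_pow_eq_pow_sum, InfinitePlace.sum_mult_eq]
      exact Finset.prod_le_prod (fun v _ => pow_nonneg (apply_nonneg _ _) _)
        (fun v _ => pow_le_pow_left₀ (apply_nonneg _ _) (hsize v).1 _)
    set P : ℝ := ∏ v ∈ Finset.univ.filter (fun v : InfinitePlace F => ¬ v.IsReal), δ v with hP
    have hP0 : 0 < P := Finset.prod_pos fun v _ => hδ v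
    have h1 : 1 ≤ B * L ^ (4 * (m - 1)) * P := by
      calc (1 : ℝ) ≤ N ^ (2 * (m - 1)) * (((2 * C) ^ (m - 1)) ^ n * P) := hmain
        _ ≤ (C ^ n * L ^ 2) ^ (2 * (m - 1)) * (((2 * C) ^ (m - 1)) ^ n * P) :=
          mul_le_mul_of_nonneg_right (pow_le_pow_left₀ hN0 hNle _) (by positivity)
        _ = B * L ^ (4 * (m - 1)) * P := by
          rw [hB, mul_pow, ← pow_mul L, show 2 * (2 * (m - 1)) = 4 * (m - 1) by ring]
          ring
    have h2 := one_le_pow₀ h1 (n := 2)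
    rw [Finset.prod_pow, ← hP]
    calc (1 : ℝ) ≤ (B * L ^ (4 * (m - 1)) * P) ^ 2 := h2
      _ = B ^ 2 * L ^ (8 * (m - 1)) * P ^ 2 := by
        rw [mul_pow, mul_pow, ← pow_mul L, show 4 * (m - 1) * 2 = 8 * (m - 1) by ring]
  · -- the subfield case
    exfalso
    obtain ⟨e, hebc, heq⟩ := hbc
    have hdet' : a * d - e = (l₁ * l₂) ^ 2 := by
      apply FaithfulSMul.algebraMap_injective (𝓞 F) F
      rw [map_sub, map_mul, map_pow, hebc]
      exact hdet
    have hz : (a + d) ^ 2 - 4 * (l₁ * l₂) ^ 2 ∈ q := by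
      have : (a + d) ^ 2 - 4 * (l₁ * l₂) ^ 2 = (a - d) * (a - d) + 4 * e := by
        rw [← hdet']; ring
      rw [this]
      exact q.add_mem (q.mul_mem_left _ had) (q.mul_mem_left _ heq)
    have hnp' : (a + d) ^ 2 - 4 * (l₁ * l₂) ^ 2 ≠ 0 := by
      intro h0
      apply hnp
      have := congrArg (algebraMap (𝓞 F) F) (sub_eq_zero.mp h0)
      simpa only [map_pow, map_mul (algebraMap (𝓞 F) F) 4, map_ofNat] using this
    have h4 : ∀ v : InfinitePlace F, v (4 : F) = 4 := by
      intro v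
      rw [← InfinitePlace.norm_embedding_eq, map_ofNat]
      simp
    have hvsub : ∀ (v : InfinitePlace F) (x y : F), v (x - y) ≤ v x + v y := by
      intro v x y
      rw [← InfinitePlace.norm_embedding_eq v x, ← InfinitePlace.norm_embedding_eq v y,
        ← InfinitePlace.norm_embedding_eq v (x - y), map_sub]
      exact norm_sub_le _ _
    set E := IntermediateField.adjoin K {ξ} with hE
    have hk : 1 < Module.finrank E F := by
      have hpos : 0 < Module.finrank E F := Module.finrank_pos
      by_contra hle
      apply hgen
      apply IntermediateField.eq_of_le_of_finrank_eq' le_top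
      rw [IntermediateField.finrank_top]
      omega
    have hsub := aux_subfield (E := E) (F := F) hk
      ⟨ξ, IntermediateField.mem_adjoin_simple_self K ξ⟩ l₁ l₂ p₁ p₂ hp₁ hp₂ hN₁ hN₂ h12 (a + d) hη
    rcases hsub with ⟨r, hr⟩ | ⟨hpp, hpd⟩
    · -- ξ is integral
      obtain ⟨s, hs⟩ : ∃ s : 𝓞 F, algebraMap (𝓞 F) F s = ξ := by
        refine ⟨algebraMap (𝓞 E) (𝓞 F) r, ?_⟩
        rw [← IsScalarTower.algebraMap_apply (𝓞 E) (𝓞 F) F,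
          IsScalarTower.algebraMap_apply (𝓞 E) E F, hr]
        rfl
      have hsl : a + d = (l₁ * l₂) * s := by
        apply FaithfulSMul.algebraMap_injective (𝓞 F) F
        rw [hη, map_mul _ (l₁ * l₂), hs]
      have hfac : (a + d) ^ 2 - 4 * (l₁ * l₂) ^ 2 = (l₁ * l₂) ^ 2 * (s ^ 2 - 4) := by
        rw [hsl]; ring
      have hs0 : s ^ 2 - 4 ≠ 0 := by
        intro h0
        rw [hfac, h0, mul_zero] at hnp'
        exact hnp' rfl
      have hsq : s ^ 2 - 4 ∈ q := by
        have hco : IsCoprime (Ideal.span {(l₁ * l₂) ^ 2}) q := by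
          rw [← Ideal.span_singleton_pow, ← Ideal.span_singleton_mul_span_singleton]
          exact (hc₁.mul_left hc₂).pow_left
        rw [← Ideal.span_singleton_le_iff_mem, ← Ideal.dvd_iff_le]
        apply hco.symm.dvd_of_dvd_mul_left
        rw [Ideal.span_singleton_mul_span_singleton, ← hfac, Ideal.dvd_iff_le,
          Ideal.span_singleton_le_iff_mem]
        exact hz
      have hle := aux_q_le q (s ^ 2 - 4) 1 (C ^ 2 + 4) hsq hs0 (by
        intro v
        rw [map_one, map_one, mul_one, map_sub, map_pow, hs, map_ofNat]
        refine (hvsub v _ _).trans ?_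
        rw [map_pow, h4]
        have := pow_le_pow_left₀ (apply_nonneg v ξ) (hvξ v) 2
        linarith)
      rw [Ideal.span_singleton_one, Ideal.absNorm_top, Nat.cast_one, mul_one] at hle
      have : 0 ≤ A * Δ ^ 4 := by positivity
      linarith
    · -- ramified prime, hence of bounded norm
      have hle := aux_q_le q _ ((l₁ * l₂) ^ 2) (C ^ 2 + 4) hz hnp' (by
        intro v
        rw [map_sub, map_mul (algebraMap (𝓞 F) F) 4, map_pow, map_pow, map_ofNat]
        refine (hvsub v _ _).trans ?_
        rw [map_pow, map_mul, map_pow, h4]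
        have := pow_le_pow_left₀ (apply_nonneg v _) (htr v) 2
        rw [mul_pow] at this
        linarith)
      rw [← Ideal.span_singleton_pow, ← Ideal.span_singleton_mul_span_singleton, map_pow, map_mul,
        hN₁, hN₂, ← hpp] at hle
      have hpΔ : (p₁ : ℝ) ≤ Δ := Nat.cast_le.mpr hpd
      have h4p : (p₁ : ℝ) ^ 4 ≤ Δ ^ 4 := pow_le_pow_left₀ (Nat.cast_nonneg _) hpΔ 4
      have : A * (p₁ : ℝ) ^ 4 ≤ A * Δ ^ 4 := mul_le_mul_of_nonneg_left h4p hApos.le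
      push_cast at hle
      have e4 : ((p₁ : ℝ) * p₁) ^ 2 = (p₁ : ℝ) ^ 4 := by ring
      rw [e4] at hle
      linarith
end
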